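/- The number of self-dual (with respect to the symplectic inner product) additive codes of length n over F_{m^2}, i.e., F_m-linear subgroups of F_{m^2}^n of size m^n that equal their own dual, is T_n = ∏_{i=1}^{n} (m^i + 1). -/

import Mathlib

open scoped BigOperators

/-- The trace map from `F_{p^r}` to the prime field `F_p`, computed inside the field `F`
    via the formula `Tr(c) = ∑_{i=0}^{r-1} c^{p^i}`. -/
def fieldTr {F : Type*} [Field F] (p r : ℕ) (x : F) : F :=
  ∑ i ∈ Finset.range r, x ^ p ^ i

/-- The symplectic (trace) inner product on `(F_m × F_m)^n`: elements of `F_{m^2}^n`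
    are represented as pairs `(a | b)` via `a + ω b`, and
    `(a|b) * (a'|b') = Tr_{m/p}(b · a' - b' · a)`. -/
def sympForm {F : Type*} [Field F] (p r : ℕ) {n : ℕ} (u v : Fin n → F × F) : F :=
  fieldTr p r (∑ i, ((u i).2 * (v i).1 - (v i).2 * (u i).1))

section Lagrangian

variable {F V : Type*} [Field F] [AddCommGroup V] [Module F V]

open Module

lemma card_mem_and_notMem [Fintype F] [Fintype V] {W W' : Submodule F V} (h : W ≤ W') :
    Nat.card {v // v ∈ W' ∧ v ∉ W} =
      Fintype.card F ^ finrank F W' - Fintype.card F ^ finrank F W := by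
  have key : ∀ X : Submodule F V, (X : Set V).ncard = Fintype.card F ^ finrank F X := fun X => by
    rw [← Nat.card_eq_fintype_card, ← Module.natCard_eq_pow_finrank (K := F) (V := X)]
    rfl
  rw [← key, ← key]
  exact Set.ncard_sdiff (s := (W : Set V)) (t := (W' : Set V)) h (Set.toFinite _)

/-- The number of Lagrangian subspaces containing a given isotropic subspace. -/
lemma card_lagrangian_of_le [Fintype F] [Fintype V] {B : LinearMap.BilinForm F V}
    (hB : B.Nondegenerate) (hA : B.IsAlt) {n : ℕ} (hn : finrank F V = 2 * n) (k : ℕ)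
    (U : Submodule F V) (hU : U ≤ B.orthogonal U) (hk : finrank F U + k = n) :
    Nat.card {L : Submodule F V // B.orthogonal L = L ∧ U ≤ L} =
      ∏ i ∈ Finset.Icc 1 k, (Fintype.card F ^ i + 1) := by
  classical
  have hR : B.IsRefl := hA.isRefl
  have hfin : ∀ W : Submodule F V, finrank F (B.orthogonal W) = 2 * n - finrank F W :=
    fun W => by rw [LinearMap.BilinForm.finrank_orthogonal hB, hn]
  have hL : ∀ L : Submodule F V, B.orthogonal L = L → finrank F L = n := fun L h => by
    have h1 := hfin L
    have h2 := Submodule.finrank_le L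
    rw [h] at h1
    omega
  induction k generalizing U with
  | zero =>
    have hUU : B.orthogonal U = U :=
      (Submodule.eq_of_le_of_finrank_eq hU (by rw [hfin]; omega)).symm
    rw [Finset.Icc_eq_empty (by norm_num), Finset.prod_empty, Nat.card_eq_one_iff_unique]
    refine ⟨⟨fun ⟨L, h1, h2⟩ ⟨L', h1', h2'⟩ => Subtype.ext (?_ : L = L')⟩, ⟨⟨U, hUU, le_rfl⟩⟩⟩
    rw [← Submodule.eq_of_le_of_finrank_eq h2 (by rw [hL L h1]; omega),
      ← Submodule.eq_of_le_of_finrank_eq h2' (by rw [hL L' h1']; omega)]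
  | succ k ih =>
    have hq : 1 < Fintype.card F := Fintype.one_lt_card
    have hcount := Finset.card_mul_eq_card_mul
      (s := Finset.univ.filter fun L : Submodule F V => B.orthogonal L = L ∧ U ≤ L)
      (t := Finset.univ.filter fun v : V => v ∈ B.orthogonal U ∧ v ∉ U)
      (fun L v => v ∈ L)
      (m := Fintype.card F ^ n - Fintype.card F ^ finrank F U)
      (n := ∏ i ∈ Finset.Icc 1 k, (Fintype.card F ^ i + 1)) ?_ ?_
    · simp only [← Fintype.card_subtype] at hcount
      rw [← Nat.card_eq_fintype_card (α := {L : Submodule F V // _}),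
        ← Nat.card_eq_fintype_card (α := {v : V // _}), card_mem_and_notMem hU, hfin] at hcount
      rw [Finset.prod_Icc_succ_top (by omega)]
      obtain ⟨d, hd⟩ : ∃ d, d = finrank F U := ⟨_, rfl⟩
      rw [← hd] at hcount hk
      subst hk
      generalize Fintype.card F = q at *
      have h1 : q ^ (d + (k + 1)) - q ^ d = q ^ d * (q ^ (k + 1) - 1) := by
        rw [Nat.mul_sub, pow_add, mul_one]
      have h2 : q ^ (2 * (d + (k + 1)) - d) - q ^ d =
          q ^ d * (q ^ (k + 1) - 1) * (q ^ (k + 1) + 1) := by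
        rw [show 2 * (d + (k + 1)) - d = d + ((k + 1) + (k + 1)) by omega, pow_add, mul_assoc,
          mul_comm (q ^ (k + 1) - 1), ← Nat.sq_sub_sq (q ^ (k + 1)) 1, Nat.mul_sub,
          pow_add q (k + 1), one_pow, mul_one, sq]
      rw [h1, h2] at hcount
      have h3 : 1 < q ^ (k + 1) := Nat.one_lt_pow (by omega) hq
      have h4 : 0 < q ^ d * (q ^ (k + 1) - 1) :=
        Nat.mul_pos (by positivity) (by omega)
      refine Nat.eq_of_mul_eq_mul_left h4 ?_
      rw [mul_comm, hcount]
      ring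
    · intro L h
      obtain ⟨h1, h2⟩ := (Finset.mem_filter.1 h).2
      rw [← hL L h1, ← card_mem_and_notMem h2, Nat.card_eq_fintype_card, Fintype.card_subtype]
      congr 1
      ext v
      have h3 : v ∈ L → v ∈ B.orthogonal U := fun hv =>
        LinearMap.BilinForm.orthogonal_le h2 (h1.symm ▸ hv)
      simp only [Finset.bipartiteAbove, Finset.mem_filter, Finset.mem_univ, true_and]
      tauto
    · intro v h
      obtain ⟨h1, h2⟩ := (Finset.mem_filter.1 h).2
      rw [← ih (U ⊔ F ∙ v) ?_ ?_, Nat.card_eq_fintype_card, Fintype.card_subtype]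
      · congr 1
        ext L
        simp only [Finset.bipartiteBelow, Finset.mem_filter, Finset.mem_univ, true_and,
          sup_le_iff, Submodule.span_singleton_le_iff_mem, and_assoc]
      · intro x hx y hy
        obtain ⟨u, hu, a, ha, rfl⟩ := Submodule.mem_sup.1 hx
        obtain ⟨u', hu', a', ha', rfl⟩ := Submodule.mem_sup.1 hy
        obtain ⟨c, rfl⟩ := Submodule.mem_span_singleton.1 ha
        obtain ⟨c', rfl⟩ := Submodule.mem_span_singleton.1 ha'
        have e1 : B u' u = 0 := hU hu u' hu'
        have e2 : B u' v = 0 := h1 u' hu'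
        have e3 : B v u = 0 := hR _ _ (h1 u hu)
        have e4 : B v v = 0 := hA v
        simp [e1, e2, e3, e4]
      · have h3 : v ≠ 0 := fun h => h2 (h ▸ U.zero_mem)
        have h4 := Submodule.finrank_sup_add_finrank_inf_eq U (F ∙ v)
        rw [finrank_span_singleton h3,
          ((Submodule.disjoint_span_singleton' h3).2 h2).eq_bot, finrank_bot] at h4
        omega

end Lagrangian

section Trace

variable {F : Type*} [Field F]

lemma fieldTr_zero {p : ℕ} (hp : p.Prime) (r : ℕ) : fieldTr p r (0 : F) = 0 :=
  Finset.sum_eq_zero fun _ _ => zero_pow (pow_pos hp.pos _).ne'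

lemma exists_fieldTr_ne_zero [Fintype F] {p r : ℕ} (hp : p.Prime) (hr : 0 < r)
    (hF : Fintype.card F = p ^ r) : ∃ x : F, fieldTr p r x ≠ 0 := by
  classical
  by_contra! h
  obtain ⟨r, rfl⟩ : ∃ s, r = s + 1 := ⟨r - 1, by omega⟩
  let P : Polynomial F := ∑ i ∈ Finset.range (r + 1), Polynomial.X ^ p ^ i
  have hdeg : P.natDegree ≤ p ^ r := by
    refine Polynomial.natDegree_sum_le_of_forall_le _ _ fun i hi => ?_
    rw [Polynomial.natDegree_X_pow]
    exact Nat.pow_le_pow_right hp.pos (by simpa [Nat.lt_succ_iff] using hi)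
  have hP : P = 0 := by
    refine Polynomial.eq_zero_of_natDegree_lt_card_of_eval_eq_zero' P Finset.univ ?_ ?_
    · intro x _
      simpa [P, Polynomial.eval_finsetSum, fieldTr] using h x
    · rw [Finset.card_univ, hF]
      exact hdeg.trans_lt (Nat.pow_lt_pow_right hp.one_lt (by omega))
  have hcoeff : P.coeff 1 = 1 := by
    simp only [P, Polynomial.finsetSum_coeff, Polynomial.coeff_X_pow]
    rw [Finset.sum_eq_single 0]
    · simp
    · intro i _ hi
      rw [if_neg (Nat.one_lt_pow hi hp.one_lt).ne]
    · simp
  simp [hP] at hcoeff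

end Trace

section Symplectic

variable (F : Type*) [Field F] (n : ℕ)

/-- The standard symplectic form on `(F × F)^n`. -/
def stdSymp : LinearMap.BilinForm F (Fin n → F × F) :=
  LinearMap.mk₂ F (fun u v => ∑ i, ((u i).2 * (v i).1 - (v i).2 * (u i).1))
    (fun u u' v => by
      rw [← Finset.sum_add_distrib]
      refine Finset.sum_congr rfl fun i _ => ?_
      simp only [Pi.add_apply, Prod.fst_add, Prod.snd_add]
      ring)
    (fun c u v => by
      rw [smul_eq_mul, Finset.mul_sum]
      refine Finset.sum_congr rfl fun i _ => ?_
      simp only [Pi.smul_apply, Prod.smul_fst, Prod.smul_snd, smul_eq_mul]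
      ring)
    (fun u v v' => by
      rw [← Finset.sum_add_distrib]
      refine Finset.sum_congr rfl fun i _ => ?_
      simp only [Pi.add_apply, Prod.fst_add, Prod.snd_add]
      ring)
    (fun c u v => by
      rw [smul_eq_mul, Finset.mul_sum]
      refine Finset.sum_congr rfl fun i _ => ?_
      simp only [Pi.smul_apply, Prod.smul_fst, Prod.smul_snd, smul_eq_mul]
      ring)

variable {F n}

lemma stdSymp_apply (u v : Fin n → F × F) :
    stdSymp F n u v = ∑ i, ((u i).2 * (v i).1 - (v i).2 * (u i).1) := rfl

variable (F n) in
lemma stdSymp_isAlt : (stdSymp F n).IsAlt := fun u => by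
  simp [stdSymp_apply]

variable (F n) in
lemma stdSymp_nondegenerate : (stdSymp F n).Nondegenerate := by
  classical
  refine (LinearMap.IsRefl.nondegenerate_iff_separatingLeft (stdSymp_isAlt F n).isRefl).2 ?_
  intro u hu
  have key : ∀ (i : Fin n) (a : F × F), (u i).2 * a.1 - a.2 * (u i).1 = 0 := fun i a => by
    have := hu (Pi.single i a)
    rw [stdSymp_apply, Finset.sum_eq_single i] at this
    · simpa using this
    · intro j _ hj
      simp [Pi.single_eq_of_ne hj]
    · simp
  ext i
  · simpa using key i (0, 1)
  · simpa using key i (1, 0)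

lemma forall_sympForm_eq_zero_iff [Fintype F] {p r : ℕ} (hp : p.Prime) (hr : 0 < r)
    (hF : Fintype.card F = p ^ r) (C : Submodule F (Fin n → F × F)) (u : Fin n → F × F) :
    (∀ c ∈ C, sympForm p r u c = 0) ↔ u ∈ (stdSymp F n).orthogonal C := by
  have hS : ∀ c, sympForm p r u c = fieldTr p r (stdSymp F n u c) := fun _ => rfl
  have hR := (stdSymp_isAlt F n).isRefl
  constructor
  · intro h c hc
    refine hR _ _ ?_
    by_contra h0
    obtain ⟨x, hx⟩ := exists_fieldTr_ne_zero hp hr hF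
    refine hx ?_
    have := h ((x / stdSymp F n u c) • c) (C.smul_mem _ hc)
    rwa [hS, map_smul, smul_eq_mul, div_mul_cancel₀ _ h0] at this
  · intro h c hc
    rw [hS, hR _ _ (h c hc), fieldTr_zero hp]

end Symplectic

/-- The number of self-dual (w.r.t. the symplectic inner product) additive codes
    of length `n` over `F_{m^2}`, i.e. `F_m`-linear subgroups of `F_{m^2}^n` of size `m^n`
    equal to their own dual, is `∏_{i=1}^n (m^i + 1)`. -/
theorem stmt0 (p r n m : ℕ) (hp : p.Prime) (hr : 0 < r) (hm : m = p ^ r)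
    (F : Type) [Field F] [Fintype F] (hF : Fintype.card F = m) :
    Nat.card {C : Submodule F (Fin n → F × F) //
        Nat.card C = m ^ n ∧ (∀ u, u ∈ C ↔ ∀ c ∈ C, sympForm p r u c = 0)} =
      ∏ i ∈ Finset.Icc 1 n, (m ^ i + 1) := by
  subst hm
  have hn : Module.finrank F (Fin n → F × F) = 2 * n := by
    simp [Module.finrank_pi_fintype, mul_comm]
  have hB := stdSymp_nondegenerate F n
  rw [← hF, ← card_lagrangian_of_le hB (stdSymp_isAlt F n) hn n ⊥ bot_le (by simp)]
  refine Nat.card_congr (Equiv.subtypeEquivRight fun C => ?_)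
  simp only [forall_sympForm_eq_zero_iff hp hr hF, bot_le, and_true]
  refine ⟨fun h => (Submodule.ext h.2).symm, fun h => ⟨?_, fun u => by rw [h]⟩⟩
  have h1 := LinearMap.BilinForm.finrank_orthogonal hB C
  have h2 := Submodule.finrank_le C
  rw [h, hn] at h1
  rw [Module.natCard_eq_pow_finrank (K := F), Nat.card_eq_fintype_card,
    show Module.finrank F C = n by omega]
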